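/- arXiv:1706.00565 — 2 statements merged into one kernel-verified Lean document; each statement's English description precedes it below -/
import Mathlib

section
/- Let 𝓐 = (A_0, A_1, 𝓕) be a two-phylum algebra with 𝓕 = 𝓖_0 ∪ 𝓖_1 ∪ 𝓗, where 𝓖_0 consists of operations on A_0 alone, 𝓖_1 consists of operations on A_1 alone, and 𝓗 is a nonempty set of unary functions from A_1 to A_0. Then for each e⃗ ∈ Ω_1, 𝓐 is an e⃗-Ramsey algebra if and only if 𝓐_1 = (A_1, 𝓖_1) is a Ramsey algebra. -/
universe u v

/-- A (heterogeneous) operation: a list of input sorts, an output sort, and an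
underlying function on lists of elements (only its values on lists of the right
length and sorts matter). -/
structure HetOp (I : Type u) (U : Type v) where
  inSorts : List I
  outSort : I
  fn : List U → U

namespace HetRamsey

variable {I : Type u} {U : Type v}

/-- `f` maps the phyla prescribed by its input sorts into the phylum of its output sort. -/
def WellSorted (A : I → Set U) (f : HetOp I U) : Prop :=
  ∀ xs : List U, List.Forall₂ (fun x ξ => x ∈ A ξ) xs f.inSorts → f.fn xs ∈ A f.outSort

/-- Apply the operations in `hs` to consecutive chunks of the list `xs`. -/
def applyChunks : List (HetOp I U) → List U → List U
  | [], _ => []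
  | h :: t, xs => h.fn (xs.take h.inSorts.length) :: applyChunks t (xs.drop h.inSorts.length)

/-- The orderly terms over a family `F` of operations: `F` itself, the identity
operations, closed under orderly composition. -/
inductive OT (F : Set (HetOp I U)) : HetOp I U → Prop
  | base {f : HetOp I U} : f ∈ F → OT F f
  | id (ξ : I) (c : HetOp I U) :
      c.inSorts = [ξ] → c.outSort = ξ → (∀ x : U, c.fn [x] = x) → OT F c
  | comp (g : HetOp I U) (hs : List (HetOp I U)) :
      g ∈ F → (∀ h ∈ hs, OT F h) →
      List.Forall₂ (fun (h : HetOp I U) ξ => h.outSort = ξ) hs g.inSorts →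
      OT F ⟨(hs.map HetOp.inSorts).flatten, g.outSort, fun xs => g.fn (applyChunks hs xs)⟩

/-- `b` is `e`-sorted: the `i`-th term lies in phylum `A (e i)`. -/
def Sorted (A : I → Set U) (e : ℕ → I) (b : ℕ → U) : Prop :=
  ∀ i, b i ∈ A (e i)

/-- `a` is a reduction of `b` with respect to the family of operations `F`:
each term `a j` is obtained by applying an orderly term over `F` to a finite
subsequence of `b`, and these finite subsequences concatenate to a
subsequence of `b`. -/
def Reduction (A : I → Set U) (F : Set (HetOp I U)) (a b : ℕ → U) : Prop :=
  ∃ (φ : ℕ → List ℕ) (f : ℕ → HetOp I U),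
    (∀ j, OT F (f j)) ∧
    (∀ j, (φ j).Chain' (· < ·)) ∧
    (∀ j k, j < k → ∀ x ∈ φ j, ∀ y ∈ φ k, x < y) ∧
    (∀ j, List.Forall₂ (fun i ξ => b i ∈ A ξ) (φ j) (f j).inSorts) ∧
    (∀ j, a j = (f j).fn ((φ j).map b))

/-- `FR^e_F(b)`: the set of first terms of `e`-sorted reductions of `b`. -/
def FR (A : I → Set U) (F : Set (HetOp I U)) (e : ℕ → I) (b : ℕ → U) : Set U :=
  { x | ∃ a : ℕ → U, Reduction A F a b ∧ Sorted A e a ∧ a 0 = x }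

/-- The algebra with phyla `A` and operations `F` is an `e`-Ramsey algebra. -/
def IsERamsey (A : I → Set U) (F : Set (HetOp I U)) (e : ℕ → I) : Prop :=
  ∀ b : ℕ → U, Sorted A e b → ∀ X : Set U, X ⊆ A (e 0) →
    ∃ a : ℕ → U, Reduction A F a b ∧ Sorted A e a ∧
      (FR A F e a ⊆ X ∨ FR A F e a ∩ X = ∅)

/-- The homogeneous algebra `(A ξ, F)` is a Ramsey algebra: it is `e`-Ramsey for
the constant sort with value `ξ`. -/
def IsRamsey (A : I → Set U) (F : Set (HetOp I U)) (ξ : I) : Prop :=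
  IsERamsey A F fun _ => ξ

/-- For a homogeneous algebra: `FR_G(α) = { f(τ) : f ∈ OT(G), τ a finite subsequence of α }`. -/
def FRfin (A : I → Set U) (G : Set (HetOp I U)) (α : ℕ → U) : Set U :=
  { x | ∃ (f : HetOp I U) (ns : List ℕ), OT G f ∧ ns.Chain' (· < ·) ∧
      List.Forall₂ (fun i ξ => α i ∈ A ξ) ns f.inSorts ∧ x = f.fn (ns.map α) }

/-- `e ∈ Ω`: every value attained by the sort `e` is attained infinitely often. -/
def InOmega (e : ℕ → I) : Prop :=
  ∀ i, {j | e j = e i}.Infinite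

end HetRamsey

namespace HetRamsey

variable {I : Type u} {U : Type v}

/-- The canonical identity operation on the phylum with index `ξ`. -/
def idOp [Inhabited U] (ξ : I) : HetOp I U :=
  ⟨[ξ], ξ, fun xs => xs.headI⟩

theorem OT_idOp [Inhabited U] (F : Set (HetOp I U)) (ξ : I) : OT F (idOp ξ) :=
  OT.id ξ _ rfl rfl fun _ => rfl

theorem OT.mono {F G : Set (HetOp I U)} (h : F ⊆ G) {f : HetOp I U} (hf : OT F f) :
    OT G f := by
  induction hf with
  | base hf => exact OT.base (h hf)
  | id ξ c h1 h2 h3 => exact OT.id ξ c h1 h2 h3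
  | comp g hs hg _ hf ih => exact OT.comp g hs (h hg) ih hf

theorem forall₂_const_right {α β : Type*} {P : α → Prop} {ξ : β} {R : α → β → Prop}
    (hR : ∀ x, R x ξ → P x) {l : List α} {m : List β} (h : List.Forall₂ R l m)
    (hm : ∀ η ∈ m, η = ξ) : ∀ x ∈ l, P x := by
  induction h with
  | nil => simp
  | cons hab _ ih =>
    rw [List.forall_mem_cons] at hm ⊢
    exact ⟨hR _ (hm.1 ▸ hab), ih hm.2⟩

theorem forall₂_applyChunks (A : I → Set U) (hs : List (HetOp I U))
    (hws : ∀ h ∈ hs, WellSorted A h) (l : List I)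
    (hl : List.Forall₂ (fun (h : HetOp I U) ξ => h.outSort = ξ) hs l) (xs : List U)
    (hxs : List.Forall₂ (fun x ξ => x ∈ A ξ) xs (hs.map HetOp.inSorts).flatten) :
    List.Forall₂ (fun x ξ => x ∈ A ξ) (applyChunks hs xs) l := by
  induction hl generalizing xs with
  | nil => exact List.Forall₂.nil
  | @cons h ξ t l' hξ _ ih =>
    rw [List.map_cons, List.flatten_cons] at hxs
    have htake := List.forall₂_take_append _ _ _ hxs
    have hdrop := List.forall₂_drop_append _ _ _ hxs
    refine List.Forall₂.cons (hξ ▸ hws h (by simp) _ htake) ?_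
    exact ih (fun k hk => hws k (by simp [hk])) _ hdrop

/-- Orderly terms over well-sorted operations are well-sorted. -/
theorem OT.wellSorted {A : I → Set U} {F : Set (HetOp I U)} (hF : ∀ f ∈ F, WellSorted A f)
    {f : HetOp I U} (hf : OT F f) : WellSorted A f := by
  induction hf with
  | base hf => exact hF _ hf
  | id ξ c h1 h2 h3 =>
    intro xs hxs
    rw [h1] at hxs
    obtain ⟨x, hx, rfl⟩ : ∃ x, x ∈ A ξ ∧ xs = [x] := by
      cases hxs with
      | cons hx ht => cases ht; exact ⟨_, hx, rfl⟩
    rwa [h2, h3]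
  | comp g hs hg _ hl ih =>
    intro xs hxs
    exact hF g hg _ (forall₂_applyChunks A hs ih _ hl xs hxs)

/-- If every operation of `F` with output sort `ξ` lies in `G` and has all inputs of sort `ξ`,
then the same holds for orderly terms. -/
theorem OT.restrict {F G : Set (HetOp I U)} {ξ : I}
    (hFG : ∀ f ∈ F, f.outSort = ξ → f ∈ G ∧ ∀ η ∈ f.inSorts, η = ξ)
    {f : HetOp I U} (hf : OT F f) (hξ : f.outSort = ξ) :
    OT G f ∧ ∀ η ∈ f.inSorts, η = ξ := by
  induction hf with
  | base hf => exact ⟨OT.base (hFG _ hf hξ).1, (hFG _ hf hξ).2⟩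
  | id ζ c h1 h2 h3 =>
    refine ⟨OT.id ζ c h1 h2 h3, ?_⟩
    rw [h1]
    intro η hη
    rw [List.mem_singleton.1 hη, ← h2, hξ]
  | comp g hs hg _ hl ih =>
    obtain ⟨hgG, hgin⟩ := hFG g hg hξ
    have hout : ∀ h ∈ hs, h.outSort = ξ := forall₂_const_right (fun _ h => h) hl hgin
    refine ⟨OT.comp g hs hgG (fun h hh => (ih h hh (hout h hh)).1) hl, ?_⟩
    intro η hη
    obtain ⟨l, hl', hηl⟩ := List.mem_flatten.1 hη
    obtain ⟨h, hh, rfl⟩ := List.mem_map.1 hl'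
    exact (ih h hh (hout h hh)).2 η hηl

/-- The value of an orderly term at a finite subsequence of `a`, followed by a subsequence of
later terms of `a`, is a reduction of `a`. -/
theorem reduction_cons_of_OT [Inhabited U] {A : I → Set U} {F : Set (HetOp I U)} {a : ℕ → U}
    {f : HetOp I U} (hf : OT F f) {ns : List ℕ} (hns : ns.IsChain (· < ·))
    (hs : List.Forall₂ (fun i ξ => a i ∈ A ξ) ns f.inSorts) {m : ℕ → ℕ} (hm : StrictMono m)
    (hlt : ∀ x ∈ ns, ∀ j, x < m j) {ξ : ℕ → I} (hξ : ∀ j, a (m j) ∈ A (ξ j)) :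
    Reduction A F (fun j => Nat.casesOn j (f.fn (ns.map a)) fun j => a (m j)) a := by
  refine ⟨fun j => Nat.casesOn j ns fun j => [m j],
    fun j => Nat.casesOn j f fun j => idOp (ξ j), ?_, ?_, ?_, ?_, ?_⟩
  · rintro (_ | j)
    exacts [hf, OT_idOp F _]
  · rintro (_ | j)
    exacts [hns, List.isChain_singleton _]
  · rintro (_ | j) (_ | k) hjk x hx y hy
    · omega
    · rw [List.mem_singleton.1 hy]
      exact hlt x hx k
    · omega
    · rw [List.mem_singleton.1 hx, List.mem_singleton.1 hy]
      exact hm (by omega)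
  · rintro (_ | j)
    exacts [hs, List.Forall₂.cons (hξ j) List.Forall₂.nil]
  · rintro (_ | j) <;> rfl

/-- For `e ∈ Ω`, the value of an orderly term of output sort `e 0` at a finite subsequence of an
`e`-sorted sequence `a` belongs to `FR^e_F(a)`. -/
theorem mem_FR_of_OT {A : I → Set U} {F : Set (HetOp I U)} {e : ℕ → I} (he : InOmega e)
    {a : ℕ → U} (ha : Sorted A e a) {f : HetOp I U} (hf : OT F f) {ns : List ℕ}
    (hns : ns.IsChain (· < ·)) (hs : List.Forall₂ (fun i ξ => a i ∈ A ξ) ns f.inSorts)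
    (hmem : f.fn (ns.map a) ∈ A (e 0)) :
    f.fn (ns.map a) ∈ FR A F e a := by
  have : Inhabited U := ⟨a 0⟩
  obtain ⟨m, hm, hme⟩ := Filter.extraction_forall_of_frequently
    (P := fun j k => e k = e (j + 1) ∧ ∀ x ∈ ns, x < k) fun j => by
      refine (Nat.frequently_atTop_iff_infinite.2 (he (j + 1))).and_eventually ?_
      filter_upwards [Filter.eventually_gt_atTop ns.sum] with k hk x hx
      exact (List.le_sum_of_mem hx).trans_lt hk
  refine ⟨_, reduction_cons_of_OT hf hns hs hm (fun x hx j => (hme j).2 x hx)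
    (ξ := fun j => e (m j)) (fun j => ha _), ?_, rfl⟩
  rintro (_ | j)
  · exact hmem
  · exact (hme j).1 ▸ ha (m j)

end HetRamsey

open HetRamsey

/-- for a two-phylum algebra `(A 0, A 1, 𝓖₀ ∪ 𝓖₁ ∪ 𝓗)` where `𝓖₀`
consists of operations on `A 0` alone, `𝓖₁` of operations on `A 1` alone, and `𝓗`
is a nonempty set of unary operations from `A 1` to `A 0`, and for any
`e ∈ Ω₁`, the algebra is `e`-Ramsey iff `(A 1, 𝓖₁)` is a Ramsey algebra. -/
theorem eRamsey_iff_matrixPart_ramsey_of_sort_one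
    {U : Type v}
    (A : Fin 2 → Set U) (G0 G1 H : Set (HetOp (Fin 2) U))
    (hne : ∀ ξ, (A ξ).Nonempty)
    (hdisj : Pairwise fun ξ η => Disjoint (A ξ) (A η))
    (hG0 : ∀ f ∈ G0, f.outSort = 0 ∧ (∀ ξ ∈ f.inSorts, ξ = 0) ∧ WellSorted A f)
    (hG1 : ∀ f ∈ G1, f.outSort = 1 ∧ (∀ ξ ∈ f.inSorts, ξ = 1) ∧ WellSorted A f)
    (hH : ∀ f ∈ H, f.inSorts = [1] ∧ f.outSort = 0 ∧ WellSorted A f)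
    (hHne : H.Nonempty)
    (e : ℕ → Fin 2) (he : InOmega e) (he0 : e 0 = 1) :
    IsERamsey A (G0 ∪ G1 ∪ H) e ↔ IsRamsey A G1 1 := by
  have hFws : ∀ f ∈ G0 ∪ G1 ∪ H, WellSorted A f := by
    rintro f ((hf | hf) | hf)
    exacts [(hG0 f hf).2.2, (hG1 f hf).2.2, (hH f hf).2.2]
  have hF1 : ∀ f ∈ G0 ∪ G1 ∪ H, f.outSort = 1 → f ∈ G1 ∧ ∀ η ∈ f.inSorts, η = 1 := by
    rintro f ((hf | hf) | hf) h1
    · exact absurd ((hG0 f hf).1.symm.trans h1) (by decide)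
    · exact ⟨hf, (hG1 f hf).2.1⟩
    · exact absurd ((hH f hf).2.1.symm.trans h1) (by decide)
  have hsub : G1 ⊆ G0 ∪ G1 ∪ H := fun f hf => Or.inl (Or.inr hf)
  have huniq : ∀ {x : U} {ξ η : Fin 2}, x ∈ A ξ → x ∈ A η → ξ = η := by
    intro x ξ η h1 h2
    by_contra hne'
    exact Set.disjoint_left.1 (hdisj hne') h1 h2
  -- A term over the whole algebra whose value lies in phylum 1 is a term over `G1`.
  have hterm : ∀ (c : ℕ → U) (f : HetOp (Fin 2) U) (ns : List ℕ), OT (G0 ∪ G1 ∪ H) f →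
      List.Forall₂ (fun i ξ => c i ∈ A ξ) ns f.inSorts → f.fn (ns.map c) ∈ A 1 →
      OT G1 f ∧ (∀ η ∈ f.inSorts, η = 1) ∧ ∀ i ∈ ns, c i ∈ A 1 := by
    intro c f ns hf hs hmem
    have hout : f.outSort = 1 :=
      huniq (hf.wellSorted hFws _ (List.forall₂_map_left_iff.2 hs)) hmem
    obtain ⟨h1, h2⟩ := hf.restrict hF1 hout
    exact ⟨h1, h2, forall₂_const_right (fun _ h => h) hs h2⟩
  obtain ⟨h, hh⟩ := hHne
  obtain ⟨hin, hout, hws⟩ := hH h hh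
  constructor
  · intro hR β hβ X hX
    obtain ⟨z, hz⟩ := hne 0
    have hb : Sorted A e fun j => if e j = 1 then β j else z := by
      intro j
      by_cases hj : e j = 1
      · simpa [hj] using hβ j
      · have hj0 : e j = 0 := by omega
        simpa [hj0] using hz
    obtain ⟨a, ⟨φ, f, hf, hφ, hlt, hs, hval⟩, ha, hfr⟩ := hR _ hb X (he0 ▸ hX)
    obtain ⟨n, hn, hn1⟩ := Filter.extraction_of_frequently_atTop
      (Nat.frequently_atTop_iff_infinite.2 (he 0))
    rw [he0] at hn1
    have hα : Sorted A (fun _ => 1) (a ∘ n) := fun k => hn1 k ▸ ha (n k)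
    have hβb : ∀ k, OT G1 (f (n k)) ∧ (∀ η ∈ (f (n k)).inSorts, η = 1) ∧
        ∀ i ∈ φ (n k), e i = 1 := by
      intro k
      obtain ⟨h1, h2, h3⟩ := hterm _ _ _ (hf (n k)) (hs (n k)) (hval (n k) ▸ hα k)
      exact ⟨h1, h2, fun i hi => huniq (hb i) (h3 i hi)⟩
    refine ⟨a ∘ n, ⟨φ ∘ n, f ∘ n, fun k => (hβb k).1, fun k => hφ _,
      fun j k hjk => hlt _ _ (hn hjk), fun k => ?_, fun k => ?_⟩, hα, ?_⟩
    · refine (List.forall₂_iff_zip.2 ⟨(hs (n k)).length_eq, fun {i ξ} hi => ?_⟩)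
      rw [(hβb k).2.1 ξ (List.of_mem_zip hi).2]
      exact hβ i
    · refine (hval (n k)).trans (congrArg _ (List.map_congr_left fun i hi => ?_))
      simp [(hβb k).2.2 i hi]
    · have hle : FR A G1 (fun _ => 1) (a ∘ n) ⊆ FR A (G0 ∪ G1 ∪ H) e a := by
        rintro x ⟨c, ⟨ψ, g, hg, hψ, -, hgs, hgv⟩, hc, rfl⟩
        have hval0 : c 0 = (g 0).fn (((ψ 0).map n).map a) := by
          rw [hgv 0, List.map_map]
        rw [hval0]
        refine mem_FR_of_OT he ha ((hg 0).mono hsub) ?_ (List.forall₂_map_left_iff.2 (hgs 0)) ?_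
        · exact List.isChain_map_of_isChain n (fun _ _ hxy => hn hxy) (hψ 0)
        · rw [← hval0, he0]
          exact hc 0
      exact hfr.imp hle.trans fun h0 =>
        Set.subset_eq_empty (Set.inter_subset_inter_left _ hle) h0
  · intro hR b hb X hX
    obtain ⟨n, hn, hn1⟩ := Filter.extraction_of_frequently_atTop
      (Nat.frequently_atTop_iff_infinite.2 (he 0))
    rw [he0] at hn1 hX
    obtain ⟨α, ⟨φ, f, hf, hφ, hlt, hs, hval⟩, hα, hfr⟩ :=
      hR (b ∘ n) (fun k => hn1 k ▸ hb (n k)) X hX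
    have hout1 : ∀ j, (f j).outSort = 1 := fun j =>
      huniq (((hf j).mono hsub).wellSorted hFws _ (List.forall₂_map_left_iff.2 (hs j)))
        (hval j ▸ hα j)
    have ha : Sorted A e fun j => if e j = 1 then α j else h.fn [α j] := by
      intro j
      by_cases hj : e j = 1
      · simpa [hj] using hα j
      · have hj0 : e j = 0 := by omega
        have := hws [α j] (by rw [hin]; exact List.Forall₂.cons (hα j) List.Forall₂.nil)
        simpa [hj0, hout] using this
    refine ⟨_, ⟨fun j => (φ j).map n, fun j => if e j = 1 then f j else
      ⟨([f j].map HetOp.inSorts).flatten, h.outSort, fun xs => h.fn (applyChunks [f j] xs)⟩,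
      fun j => ?_, fun j => ?_, fun j k hjk x hx y hy => ?_, fun j => ?_, fun j => ?_⟩, ha, ?_⟩
    · dsimp only
      split_ifs
      · exact (hf j).mono hsub
      · refine OT.comp h [f j] (Or.inr hh) (by simpa using (hf j).mono hsub) ?_
        rw [hin]
        exact List.Forall₂.cons (hout1 j) List.Forall₂.nil
    · exact List.isChain_map_of_isChain n (fun _ _ hxy => hn hxy) (hφ j)
    · obtain ⟨x', hx', rfl⟩ := List.mem_map.1 hx
      obtain ⟨y', hy', rfl⟩ := List.mem_map.1 hy
      exact hn (hlt j k hjk x' hx' y' hy')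
    · have : (if e j = 1 then f j else ⟨([f j].map HetOp.inSorts).flatten, h.outSort,
          fun xs => h.fn (applyChunks [f j] xs)⟩ : HetOp (Fin 2) U).inSorts = (f j).inSorts := by
        split_ifs <;> simp
      rw [this]
      exact List.forall₂_map_left_iff.2 (hs j)
    · have hlen : (f j).inSorts.length = (φ j).length := (hs j).length_eq.symm
      by_cases hj : e j = 1
      · simp [hj, hval j]
      · simp [hj, applyChunks, hval j, hlen, List.take_of_length_le]
    · have hle : FR A (G0 ∪ G1 ∪ H) e (fun j => if e j = 1 then α j else h.fn [α j]) ⊆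
          FR A G1 (fun _ => 1) α := by
        rintro x ⟨c, ⟨ψ, g, hg, hψ, -, hgs, hgv⟩, hc, rfl⟩
        have hc0 : c 0 ∈ A 1 := he0 ▸ hc 0
        obtain ⟨h1, h2, h3⟩ := hterm _ _ _ (hg 0) (hgs 0) (hgv 0 ▸ hc0)
        have hval0 : c 0 = (g 0).fn ((ψ 0).map α) := by
          refine (hgv 0).trans (congrArg _ (List.map_congr_left fun i hi => ?_))
          simp [huniq (ha i) (h3 i hi)]
        rw [hval0]
        refine mem_FR_of_OT (fun _ => by simpa using Set.infinite_univ) hα h1 (hψ 0) ?_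
          (hval0 ▸ hc0)
        refine List.forall₂_iff_zip.2 ⟨(hgs 0).length_eq, fun {i ξ} hi => ?_⟩
        rw [h2 ξ (List.of_mem_zip hi).2]
        exact hα i
      exact hfr.imp hle.trans fun h0 =>
        Set.subset_eq_empty (Set.inter_subset_inter_left _ hle) h0
end

section
/- For each positive integer n and each e⃗ ∈ Ω_0, the matrix algebras (M_n(𝔽), 𝔽, |·|), (M_n(𝔽), 𝔽, +, |·|), and (M_n(𝔽), 𝔽, ×, |·|) are e⃗-Ramsey algebras. -/
universe u v

namespace HetRamsey

/-- The underlying universe of a matrix algebra: scalars (left) and matrices (right). -/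
abbrev MatU (𝔽 : Type) (n : ℕ) : Type := 𝔽 ⊕ Matrix (Fin n) (Fin n) 𝔽

/-- The two phyla: index `0` is the scalar phylum `𝔽`, index `1` the matrix phylum. -/
def matPhyla (𝔽 : Type) (n : ℕ) : Fin 2 → Set (MatU 𝔽 n) :=
  fun i => if i = 0 then Set.range Sum.inl else Set.range Sum.inr

def toScal {𝔽 : Type} [Zero 𝔽] {n : ℕ} : MatU 𝔽 n → 𝔽
  | Sum.inl r => r
  | Sum.inr _ => 0

def toMat {𝔽 : Type} [Zero 𝔽] {n : ℕ} : MatU 𝔽 n → Matrix (Fin n) (Fin n) 𝔽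
  | Sum.inl _ => 0
  | Sum.inr m => m

/-- Matrix addition as a heterogeneous operation. -/
def matAddOp (𝔽 : Type) [Field 𝔽] (n : ℕ) : HetOp (Fin 2) (MatU 𝔽 n) :=
  ⟨[1, 1], 1, fun xs => match xs with
    | [x, y] => Sum.inr (toMat x + toMat y)
    | _ => Sum.inl 0⟩

/-- Matrix multiplication as a heterogeneous operation. -/
def matMulOp (𝔽 : Type) [Field 𝔽] (n : ℕ) : HetOp (Fin 2) (MatU 𝔽 n) :=
  ⟨[1, 1], 1, fun xs => match xs with
    | [x, y] => Sum.inr (toMat x * toMat y)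
    | _ => Sum.inl 0⟩

/-- Field addition as a heterogeneous operation. -/
def scalAddOp (𝔽 : Type) [Field 𝔽] (n : ℕ) : HetOp (Fin 2) (MatU 𝔽 n) :=
  ⟨[0, 0], 0, fun xs => match xs with
    | [x, y] => Sum.inl (toScal x + toScal y)
    | _ => Sum.inl 0⟩

/-- Field multiplication as a heterogeneous operation. -/
def scalMulOp (𝔽 : Type) [Field 𝔽] (n : ℕ) : HetOp (Fin 2) (MatU 𝔽 n) :=
  ⟨[0, 0], 0, fun xs => match xs with
    | [x, y] => Sum.inl (toScal x * toScal y)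
    | _ => Sum.inl 0⟩

/-- The determinant as a heterogeneous operation from the matrix phylum to the scalar phylum. -/
def detOp (𝔽 : Type) [Field 𝔽] (n : ℕ) : HetOp (Fin 2) (MatU 𝔽 n) :=
  ⟨[1], 0, fun xs => match xs with
    | [x] => Sum.inl (toMat x).det
    | _ => Sum.inl 0⟩

end HetRamsey

open HetRamsey

namespace HetRamsey

section Words

/-- The product of the letters `m i` of a nonempty word of indices, for the operation `op`. -/
def wordEval {M : Type*} (op : M → M → M) (m : ℕ → M) (w : FreeSemigroup ℕ) : M :=
  (w.tail.map m).foldl op (m w.head)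

/-- The list of letters of a nonempty word. -/
def letters (w : FreeSemigroup ℕ) : List ℕ := w.head :: w.tail

theorem letters_mul (v w : FreeSemigroup ℕ) : letters (v * w) = letters v ++ letters w := rfl

theorem wordEval_mul {M : Type*} (op : M → M → M) [Std.Associative op] (m : ℕ → M)
    (v w : FreeSemigroup ℕ) :
    wordEval op m (v * w) = op (wordEval op m v) (wordEval op m w) := by
  simp [wordEval, List.foldl_append, List.foldl_assoc]

theorem foldl_wordEval {M : Type*} (op : M → M → M) [Std.Associative op] (m : ℕ → M)
    (ws : List (FreeSemigroup ℕ)) (w : FreeSemigroup ℕ) :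
    (ws.map (wordEval op m)).foldl op (wordEval op m w) =
      wordEval op m (ws.foldl (· * ·) w) := by
  induction ws generalizing w with
  | nil => rfl
  | cons v ws ih => simp only [List.map_cons, List.foldl_cons, ← wordEval_mul, ih]

theorem FP_drop_antitone {M : Type*} [Semigroup M] (a : Stream' M) {i j : ℕ} (hij : i ≤ j) :
    Hindman.FP (a.drop j) ⊆ Hindman.FP (a.drop i) := by
  obtain ⟨d, rfl⟩ := Nat.exists_eq_add_of_le hij
  rw [add_comm, ← Stream'.drop_drop]
  convert Hindman.FP_drop_subset_FP (a.drop i) d using 2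
  simp [Stream'.drop_drop, add_comm]

theorem foldl_mul_mem_FP {M : Type*} [Semigroup M] (a : Stream' M) (i : ℕ) (is : List ℕ)
    (h : (i :: is).IsChain (· < ·)) :
    (is.map a.get).foldl (· * ·) (a.get i) ∈ Hindman.FP (a.drop i) := by
  induction is generalizing i with
  | nil => simpa using Hindman.FP.singleton (a.drop i) 0
  | cons j is ih =>
    rw [List.isChain_cons_cons] at h
    have hmem := FP_drop_antitone a (Nat.succ_le_of_lt h.1) (ih j h.2)
    rw [List.map_cons, List.foldl_cons, List.foldl_assoc]
    have := Hindman.FP.cons (a.drop i) _ (by rwa [Stream'.tail_eq_drop, Stream'.drop_drop])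
    simpa using this

theorem letters_of_mem_FP {a : Stream' (FreeSemigroup ℕ)} {w : FreeSemigroup ℕ}
    (hw : w ∈ Hindman.FP a) :
    ∀ k, a = (fun i => FreeSemigroup.of (k + i) : Stream' (FreeSemigroup ℕ)) →
      (letters w).Pairwise (· < ·) ∧ ∀ i ∈ letters w, k ≤ i := by
  have htail : ∀ k, Stream'.tail (fun i => FreeSemigroup.of (k + i) : Stream' _) =
      (fun i => FreeSemigroup.of (k + 1 + i) : Stream' (FreeSemigroup ℕ)) := by
    intro k
    ext1 i
    exact congrArg FreeSemigroup.of (by ring)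
  induction hw with
  | head' a =>
    rintro k rfl
    simp [letters, Stream'.head, Stream'.get]
  | tail' a w _ ih =>
    rintro k rfl
    obtain ⟨h₁, h₂⟩ := ih (k + 1) (htail k)
    exact ⟨h₁, fun i hi => by have := h₂ i hi; omega⟩
  | cons' a w _ ih =>
    rintro k rfl
    obtain ⟨h₁, h₂⟩ := ih (k + 1) (htail k)
    have hhead : letters (Stream'.head (fun i => FreeSemigroup.of (k + i) : Stream' _)) = [k] := rfl
    rw [letters_mul, hhead]
    simp only [List.singleton_append, List.pairwise_cons, List.mem_cons, forall_eq_or_imp]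
    exact ⟨⟨fun i hi => h₂ i hi, h₁⟩, le_rfl, fun i hi => by have := h₂ i hi; omega⟩

/-- Hindman's theorem for words: every set of words either contains or misses all ordered products
of some sequence of increasing words, any two of which are consecutive blocks. -/
theorem exists_blocks (P : FreeSemigroup ℕ → Prop) :
    ∃ W : ℕ → FreeSemigroup ℕ,
      (∀ i, (letters (W i)).Pairwise (· < ·)) ∧
      (∀ i j, i < j → ∀ x ∈ letters (W i), ∀ y ∈ letters (W j), x < y) ∧
      ((∀ i is, (i :: is).IsChain (· < ·) → P ((is.map W).foldl (· * ·) (W i))) ∨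
        (∀ i is, (i :: is).IsChain (· < ·) → ¬ P ((is.map W).foldl (· * ·) (W i)))) := by
  let a : Stream' (FreeSemigroup ℕ) := fun i => FreeSemigroup.of (0 + i)
  obtain ⟨c, hc, W, hW⟩ := Hindman.FP_partition_regular a
    {Hindman.FP a ∩ {w | P w}, Hindman.FP a ∩ {w | ¬ P w}} (Set.toFinite _) (by
      intro w hw
      by_cases hP : P w
      · exact ⟨_, Or.inl rfl, hw, hP⟩
      · exact ⟨_, Or.inr rfl, hw, hP⟩)
  have hca : c ⊆ Hindman.FP a := by
    rcases hc with rfl | rfl <;> exact Set.inter_subset_left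
  have hmem : ∀ i is, (i :: is).IsChain (· < ·) → (is.map W.get).foldl (· * ·) (W.get i) ∈ c :=
    fun i is h => hW (Hindman.FP_drop_subset_FP W i (foldl_mul_mem_FP W i is h))
  refine ⟨W.get, fun i => (letters_of_mem_FP (hca (hmem i [] (by simp))) 0 rfl).1,
    fun i j hij => ?_, ?_⟩
  · have h := (letters_of_mem_FP (hca (hmem i [j] (by simpa using hij))) 0 rfl).1
    exact (List.pairwise_append.mp h).2.2
  · rcases hc with rfl | rfl
    · exact Or.inl fun i is h => (hmem i is h).2
    · exact Or.inr fun i is h => (hmem i is h).2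

end Words

section Terms

variable {𝔽 : Type} {n : ℕ}

theorem mem_matPhyla_zero {x : MatU 𝔽 n} : x ∈ matPhyla 𝔽 n 0 ↔ ∃ r, x = Sum.inl r := by
  simp [matPhyla, eq_comm]

theorem mem_matPhyla_one {x : MatU 𝔽 n} : x ∈ matPhyla 𝔽 n 1 ↔ ∃ m, x = Sum.inr m := by
  simp [matPhyla, eq_comm]

variable [Field 𝔽]

/-- The operation `g` realises the binary operation `op` on matrices. -/
def Realises (op : Matrix (Fin n) (Fin n) 𝔽 → Matrix (Fin n) (Fin n) 𝔽 → Matrix (Fin n) (Fin n) 𝔽)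
    (g : HetOp (Fin 2) (MatU 𝔽 n)) : Prop :=
  g.inSorts = [1, 1] ∧ g.outSort = 1 ∧ ∀ x y, g.fn [Sum.inr x, Sum.inr y] = Sum.inr (op x y)

variable {op : Matrix (Fin n) (Fin n) 𝔽 → Matrix (Fin n) (Fin n) 𝔽 → Matrix (Fin n) (Fin n) 𝔽}
  {F : Set (HetOp (Fin 2) (MatU 𝔽 n))}

/-- An orderly term applied to well-sorted arguments returns a scalar unchanged, combines a
nonempty list of matrices by `op`, or takes the determinant of such a combination. -/
theorem OT.value [Std.Associative op] (hF : ∀ g ∈ F, g = detOp 𝔽 n ∨ Realises op g)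
    {f : HetOp (Fin 2) (MatU 𝔽 n)} (hf : OT F f) :
    ∀ xs : List (MatU 𝔽 n), List.Forall₂ (fun x ξ => x ∈ matPhyla 𝔽 n ξ) xs f.inSorts →
      (f.outSort = 0 ∧ ∃ r, xs = [Sum.inl r] ∧ f.fn xs = Sum.inl r) ∨
      ∃ m ms, xs = (m :: ms).map Sum.inr ∧
        ((f.outSort = 1 ∧ f.fn xs = Sum.inr (ms.foldl op m)) ∨
          (f.outSort = 0 ∧ f.fn xs = Sum.inl (ms.foldl op m).det)) := by
  induction hf with
  | @base f hf =>
    intro xs hxs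
    right
    rcases hF f hf with rfl | ⟨h_in, h_out, h_fn⟩
    · simp only [detOp, List.forall₂_cons_right_iff, List.forall₂_nil_right_iff,
        mem_matPhyla_one] at hxs
      obtain ⟨_, _, ⟨m, rfl⟩, rfl, rfl⟩ := hxs
      exact ⟨m, [], rfl, Or.inr ⟨rfl, rfl⟩⟩
    · simp only [h_in, List.forall₂_cons_right_iff, List.forall₂_nil_right_iff,
        mem_matPhyla_one] at hxs
      obtain ⟨_, _, ⟨x, rfl⟩, ⟨_, _, ⟨y, rfl⟩, rfl, rfl⟩, rfl⟩ := hxs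
      exact ⟨x, [y], rfl, Or.inl ⟨h_out, h_fn x y⟩⟩
  | id ξ c h_in h_out h_fn =>
    intro xs hxs
    simp only [h_in, List.forall₂_cons_right_iff, List.forall₂_nil_right_iff] at hxs
    obtain ⟨x, _, hx, rfl, rfl⟩ := hxs
    rw [h_fn, h_out]
    fin_cases ξ
    · obtain ⟨r, rfl⟩ := mem_matPhyla_zero.mp hx
      exact Or.inl ⟨rfl, r, rfl, rfl⟩
    · obtain ⟨m, rfl⟩ := mem_matPhyla_one.mp hx
      exact Or.inr ⟨m, [], rfl, Or.inl ⟨rfl, rfl⟩⟩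
  | comp g hs hg _ h_sorts ih =>
    intro xs hxs
    right
    rcases hF g hg with rfl | ⟨h_in, h_out, h_fn⟩
    · simp only [detOp, List.forall₂_cons_right_iff, List.forall₂_nil_right_iff] at h_sorts
      obtain ⟨h, _, hh, rfl, rfl⟩ := h_sorts
      simp only [List.map_cons, List.map_nil, List.flatten_cons, List.flatten_nil,
        List.append_nil] at hxs
      rcases ih h (by simp) xs hxs with ⟨h0, _⟩ | ⟨m, ms, rfl, ⟨_, h1⟩ | ⟨h0, _⟩⟩
      · simp [hh] at h0
      · refine ⟨m, ms, rfl, Or.inr ⟨rfl, ?_⟩⟩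
        simp only [applyChunks]
        rw [← hxs.length_eq, List.take_length, h1]
        rfl
      · simp [hh] at h0
    · simp only [h_in, List.forall₂_cons_right_iff, List.forall₂_nil_right_iff] at h_sorts
      obtain ⟨h₁, _, hh₁, ⟨h₂, _, hh₂, rfl, rfl⟩, rfl⟩ := h_sorts
      simp only [List.map_cons, List.map_nil, List.flatten_cons, List.flatten_nil,
        List.append_nil] at hxs
      have hx₁ := List.forall₂_take_append _ _ _ hxs
      have hx₂ := List.forall₂_drop_append _ _ _ hxs
      rcases ih h₁ (by simp) _ hx₁ with ⟨h0, _⟩ | ⟨m₁, ms₁, e₁, ⟨_, v₁⟩ | ⟨h0, _⟩⟩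
      · simp [hh₁] at h0
      · rcases ih h₂ (by simp) _ hx₂ with ⟨h0, _⟩ | ⟨m₂, ms₂, e₂, ⟨_, v₂⟩ | ⟨h0, _⟩⟩
        · simp [hh₂] at h0
        · refine ⟨m₁, ms₁ ++ m₂ :: ms₂, ?_, Or.inl ⟨h_out, ?_⟩⟩
          · rw [← List.take_append_drop h₁.inSorts.length xs, e₁, e₂]
            simp
          · simp only [applyChunks]
            rw [← hx₂.length_eq, List.take_length, v₁, v₂, h_fn]
            simp [List.foldl_append, List.foldl_assoc]
        · simp [hh₂] at h0
      · simp [hh₁] at h0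

/-- Every scalar obtained as the first term of a reduction is an entry of the original sequence or
the determinant of a combination of some of its matrix entries. -/
theorem mem_FR_scalar [Std.Associative op] (hF : ∀ g ∈ F, g = detOp 𝔽 n ∨ Realises op g)
    {e : ℕ → Fin 2} (he0 : e 0 = 0) {a : ℕ → MatU 𝔽 n} {x : MatU 𝔽 n}
    (hx : x ∈ FR (matPhyla 𝔽 n) F e a) :
    (∃ i r, a i = Sum.inl r ∧ x = a i) ∨
      ∃ i is m ms, (i :: is).IsChain (· < ·) ∧ (i :: is).map a = (m :: ms).map Sum.inr ∧
        x = Sum.inl (ms.foldl op m).det := by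
  obtain ⟨c, ⟨φ, f, hf, hφ, -, hs, hv⟩, hc, rfl⟩ := hx
  have hc0 := hc 0
  rw [he0, mem_matPhyla_zero] at hc0
  obtain ⟨s, hs0⟩ := hc0
  rcases OT.value hF (hf 0) ((φ 0).map a) (List.forall₂_map_left_iff.mpr (hs 0)) with
    ⟨_, r, h₁, h₂⟩ | ⟨m, ms, h₁, ⟨_, h₂⟩ | ⟨_, h₂⟩⟩
  · obtain ⟨i, _, _⟩ := List.map_eq_singleton_iff.mp h₁
    exact Or.inl ⟨i, r, by assumption, by simp_all⟩
  · rw [hv 0, h₂] at hs0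
    cases hs0
  · right
    cases hl : φ 0 with
    | nil => simp [hl] at h₁
    | cons i is => exact ⟨i, is, m, ms, hl ▸ hφ 0, hl ▸ h₁, by rw [hv 0, h₂]⟩

/-- Every word in matrices can be evaluated by an orderly term on some of its letters. -/
def Evaluates (op : Matrix (Fin n) (Fin n) 𝔽 → Matrix (Fin n) (Fin n) 𝔽 → Matrix (Fin n) (Fin n) 𝔽)
    (F : Set (HetOp (Fin 2) (MatU 𝔽 n))) : Prop :=
  ∀ w : FreeSemigroup ℕ, ∃ (l : List ℕ) (f : HetOp (Fin 2) (MatU 𝔽 n)), l.Sublist (letters w) ∧ OT F f ∧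
    f.inSorts = List.replicate l.length 1 ∧ f.outSort = 1 ∧
    ∀ m : ℕ → Matrix (Fin n) (Fin n) 𝔽,
      f.fn (l.map fun i => Sum.inr (m i)) = Sum.inr (wordEval op m w)

theorem isERamsey_of_evaluates [Std.Associative op]
    (hF : ∀ g ∈ F, g = detOp 𝔽 n ∨ Realises op g) (hdet : detOp 𝔽 n ∈ F)
    (hev : Evaluates op F) {e : ℕ → Fin 2} (he0 : e 0 = 0) (hinf : {j | e j = 1}.Infinite) :
    IsERamsey (matPhyla 𝔽 n) F e := by
  intro b hb X hX
  have hι := Nat.nth_strictMono hinf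
  have hb1 : ∀ i, ∃ m, b (Nat.nth (fun j => e j = 1) i) = Sum.inr m := fun i => by
    have h := hb (Nat.nth (fun j => e j = 1) i)
    rwa [show e (Nat.nth (fun j => e j = 1) i) = 1 from Nat.nth_mem_of_infinite hinf i,
      mem_matPhyla_one] at h
  generalize Nat.nth (fun j => e j = 1) = ι at hι hb1
  choose m hm using hb1
  obtain ⟨W, hinc, hblock, hP⟩ :=
    exists_blocks fun w => (Sum.inl (wordEval op m w).det : MatU 𝔽 n) ∈ X
  choose l f hl hf h_in h_out h_fn using hev
  have hmap : ∀ w, ((l w).map ι).map b = (l w).map fun i => Sum.inr (m i) := fun w => by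
    simp only [List.map_map]
    exact List.map_congr_left fun i _ => hm i
  let a : ℕ → MatU 𝔽 n := fun i =>
    if e i = 0 then Sum.inl (wordEval op m (W i)).det else Sum.inr (wordEval op m (W i))
  let det' : FreeSemigroup ℕ → HetOp (Fin 2) (MatU 𝔽 n) := fun w =>
    ⟨([f w].map HetOp.inSorts).flatten, (detOp 𝔽 n).outSort,
      fun xs => (detOp 𝔽 n).fn (applyChunks [f w] xs)⟩
  refine ⟨a, ⟨fun j => (l (W j)).map ι, fun j => if e j = 0 then det' (W j) else f (W j),
    fun j => ?_, fun j => ?_, fun j k hjk => ?_, fun j => ?_, fun j => ?_⟩, fun j => ?_, ?_⟩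
  · dsimp only
    split_ifs
    · exact OT.comp _ _ hdet (by simpa using hf (W j)) (by simp [detOp, h_out])
    · exact hf _
  · refine List.Pairwise.isChain (List.pairwise_map.mpr ?_)
    exact ((hinc j).sublist (hl _)).imp fun h => hι h
  · simp only [List.mem_map]
    rintro _ ⟨x, hx, rfl⟩ _ ⟨y, hy, rfl⟩
    exact hι (hblock j k hjk x ((hl _).subset hx) y ((hl _).subset hy))
  · have h_sorts : (if e j = 0 then det' (W j) else f (W j)).inSorts =
        (l (W j)).map fun _ => (1 : Fin 2) := by
      split_ifs <;> simp [det', h_in]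
    rw [h_sorts, List.forall₂_map_left_iff, List.forall₂_map_right_iff, List.forall₂_same]
    exact fun i _ => mem_matPhyla_one.mpr ⟨_, hm i⟩
  · simp only [a, hmap]
    split_ifs
    · have h_len : (f (W j)).inSorts.length =
          ((l (W j)).map fun i => (Sum.inr (m i) : MatU 𝔽 n)).length := by simp [h_in]
      simp only [det', applyChunks]
      rw [h_len, List.take_length, h_fn]
      rfl
    · rw [h_fn]
  · simp only [a]
    split_ifs with h
    · rw [h, mem_matPhyla_zero]
      exact ⟨_, rfl⟩
    · rw [Fin.eq_one_of_ne_zero _ h, mem_matPhyla_one]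
      exact ⟨_, rfl⟩
  · have key : ∀ x ∈ FR (matPhyla 𝔽 n) F e a, ∃ i is, (i :: is).IsChain (· < ·) ∧
        x = Sum.inl (wordEval op m ((is.map W).foldl (· * ·) (W i))).det := by
      intro x hx
      rcases mem_FR_scalar hF he0 hx with ⟨i, r, hr, rfl⟩ | ⟨i, is, m', ms, hch, hmap, rfl⟩
      · refine ⟨i, [], by simp, ?_⟩
        simp only [a] at hr ⊢
        split_ifs at hr ⊢
        rfl
      · refine ⟨i, is, hch, ?_⟩
        have hval : ∀ j, toMat (a j) = wordEval op m (W j) ∨ ∃ r, a j = Sum.inl r := fun j => by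
          simp only [a]
          split_ifs
          · exact Or.inr ⟨_, rfl⟩
          · exact Or.inl rfl
        have hms : m' :: ms = (i :: is).map fun j => wordEval op m (W j) := by
          have h := congrArg (List.map toMat) hmap
          simp only [List.map_map] at h
          rw [show (toMat ∘ Sum.inr : Matrix (Fin n) (Fin n) 𝔽 → _) = id from rfl,
            List.map_id] at h
          rw [← h]
          refine List.map_congr_left fun j hj => (hval j).resolve_right ?_
          rintro ⟨r, hr⟩
          have := List.mem_map_of_mem (f := a) hj
          rw [hmap, hr] at this
          simp at this
        simp only [List.map_cons, List.cons.injEq] at hms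
        rw [hms.1, hms.2, ← foldl_wordEval, List.map_map]
        rfl
    rcases hP with hP | hP
    · left
      intro x hx
      obtain ⟨i, is, hch, rfl⟩ := key x hx
      exact hP i is hch
    · right
      rw [Set.eq_empty_iff_forall_notMem]
      rintro x ⟨hx, hxX⟩
      obtain ⟨i, is, hch, rfl⟩ := key x hx
      exact hP i is hch hxX

theorem isERamsey_of_forall_eq_zero [Std.Associative op]
    (hF : ∀ g ∈ F, g = detOp 𝔽 n ∨ Realises op g) {e : ℕ → Fin 2} (he : ∀ i, e i = 0) :
    IsERamsey (matPhyla 𝔽 n) F e := by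
  intro b hb X hX
  have hb0 : ∀ i, ∃ r, b i = Sum.inl r := fun i => mem_matPhyla_zero.mp (he i ▸ hb i)
  obtain ⟨ι, hι, hι'⟩ : ∃ ι : ℕ → ℕ, StrictMono ι ∧ ((∀ i, b (ι i) ∈ X) ∨ ∀ i, b (ι i) ∉ X) := by
    by_cases h : {i | b i ∈ X}.Infinite
    · exact ⟨_, Nat.nth_strictMono h, Or.inl fun i => Nat.nth_mem_of_infinite h i⟩
    · have h' : {i | b i ∉ X}.Infinite := (Set.not_infinite.mp h).infinite_compl
      exact ⟨_, Nat.nth_strictMono h', Or.inr fun i => Nat.nth_mem_of_infinite h' i⟩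
  refine ⟨b ∘ ι, ⟨fun j => [ι j], fun _ => ⟨[0], 0, fun xs => xs.headD (Sum.inl 0)⟩,
    fun j => OT.id 0 _ rfl rfl fun _ => rfl, fun j => List.isChain_singleton _,
    fun j k hjk => by simpa using hι hjk, fun j => ?_, fun j => rfl⟩, fun j => ?_, ?_⟩
  · simpa using mem_matPhyla_zero.mpr (hb0 (ι j))
  · rw [he j]
    exact mem_matPhyla_zero.mpr (hb0 (ι j))
  · have key : ∀ x ∈ FR (matPhyla 𝔽 n) F e (b ∘ ι), ∃ i, x = b (ι i) := by
      intro x hx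
      rcases mem_FR_scalar hF (he 0) hx with ⟨i, r, hr, rfl⟩ | ⟨i, is, m, ms, -, hmap, -⟩
      · exact ⟨i, rfl⟩
      · obtain ⟨r, hr⟩ := hb0 (ι i)
        simp [hr] at hmap
    rcases hι' with h | h
    · left
      intro x hx
      obtain ⟨i, rfl⟩ := key x hx
      exact h i
    · right
      rw [Set.eq_empty_iff_forall_notMem]
      rintro x ⟨hx, hxX⟩
      obtain ⟨i, rfl⟩ := key x hx
      exact h i hxX

theorem isERamsey_of_inOmega [Std.Associative op]
    (hF : ∀ g ∈ F, g = detOp 𝔽 n ∨ Realises op g) (hdet : detOp 𝔽 n ∈ F)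
    (hev : Evaluates op F) {e : ℕ → Fin 2} (he : InOmega e) (he0 : e 0 = 0) :
    IsERamsey (matPhyla 𝔽 n) F e := by
  by_cases h : ∀ i, e i = 0
  · exact isERamsey_of_forall_eq_zero hF h
  · obtain ⟨i, hi⟩ := not_forall.mp h
    have hinf := he i
    rw [Fin.eq_one_of_ne_zero _ hi] at hinf
    exact isERamsey_of_evaluates hF hdet hev he0 hinf

/-- The identity term on the matrix phylum. -/
def matId (𝔽 : Type) [Field 𝔽] (n : ℕ) : HetOp (Fin 2) (MatU 𝔽 n) :=
  ⟨[1], 1, fun xs => xs.headD (Sum.inl 0)⟩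

theorem OT_matId : OT F (matId 𝔽 n) :=
  OT.id 1 _ rfl rfl fun _ => rfl

theorem evaluates_fst : Evaluates (fun x _ => x) F := by
  intro w
  refine ⟨[w.head], matId 𝔽 n, by simp [letters], OT_matId, rfl, rfl, fun m => ?_⟩
  have h : ∀ (ms : List (Matrix (Fin n) (Fin n) 𝔽)) (x : Matrix (Fin n) (Fin n) 𝔽),
      ms.foldl (fun x _ => x) x = x := by
    intro ms x
    induction ms with
    | nil => rfl
    | cons y ms ih => exact ih
  simp [wordEval, h, matId]

theorem evaluates_of_realises [Std.Associative op] {g : HetOp (Fin 2) (MatU 𝔽 n)} (hgF : g ∈ F)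
    (hg : Realises op g) : Evaluates op F := by
  have h : ∀ k, ∃ f, OT F f ∧ f.inSorts = List.replicate (k + 1) 1 ∧ f.outSort = 1 ∧
      ∀ m ms, ms.length = k → f.fn ((m :: ms).map Sum.inr) = Sum.inr (ms.foldl op m) := by
    intro k
    induction k with
    | zero =>
      refine ⟨matId 𝔽 n, OT_matId, rfl, rfl, fun m ms hms => ?_⟩
      rw [List.length_eq_zero_iff] at hms
      subst hms
      rfl
    | succ k ih =>
      obtain ⟨f, hf, h_in, h_out, h_fn⟩ := ih
      refine ⟨_, OT.comp g [matId 𝔽 n, f] hgF ?_ ?_, ?_, hg.2.1, ?_⟩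
      · simpa using ⟨OT_matId, hf⟩
      · simp [hg.1, h_out, matId]
      · simp [matId, h_in, List.replicate_succ]
      · rintro m (_ | ⟨m', ms⟩) hms
        · simp at hms
        · have h_len : f.inSorts.length =
              ((m' :: ms).map (Sum.inr : _ → MatU 𝔽 n)).length := by
            simpa [h_in] using hms.symm
          have h_val := h_fn m' ms (by simpa using hms)
          have h_id : (matId 𝔽 n).fn [Sum.inr m] = Sum.inr m := rfl
          have h_one : (matId 𝔽 n).inSorts.length = 1 := rfl
          simp only [applyChunks, h_one, List.map_cons, List.take_succ_cons, List.take_zero,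
            List.drop_succ_cons, List.drop_zero, h_id]
          rw [← List.map_cons, h_len, List.take_length, h_val, hg.2.2, List.foldl_cons,
            List.foldl_assoc]
  intro w
  obtain ⟨f, hf, h_in, h_out, h_fn⟩ := h w.tail.length
  refine ⟨letters w, f, List.Sublist.refl _, hf, h_in, h_out, fun m => ?_⟩
  simpa [letters, wordEval, Function.comp_def] using h_fn (m w.head) (w.tail.map m) (by simp)

end Terms

end HetRamsey

/-- for `e ∈ Ω₀`, the matrix algebras `(Mₙ(𝔽), 𝔽, |·|)`,
`(Mₙ(𝔽), 𝔽, +, |·|)` and `(Mₙ(𝔽), 𝔽, ×, |·|)` are `e`-Ramsey algebras. -/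
theorem det_matAdd_matMul_reducts_eRamsey
    (𝔽 : Type) [Field 𝔽] [CharZero 𝔽] (n : ℕ) (hn : 0 < n)
    (e : ℕ → Fin 2) (he : InOmega e) (he0 : e 0 = 0) :
    IsERamsey (matPhyla 𝔽 n) {detOp 𝔽 n} e ∧
    IsERamsey (matPhyla 𝔽 n) {matAddOp 𝔽 n, detOp 𝔽 n} e ∧
    IsERamsey (matPhyla 𝔽 n) {matMulOp 𝔽 n, detOp 𝔽 n} e := by
  have : Std.Associative (fun x _ : Matrix (Fin n) (Fin n) 𝔽 => x) := ⟨fun _ _ _ => rfl⟩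
  have hadd : Realises (· + ·) (matAddOp 𝔽 n) := ⟨rfl, rfl, fun _ _ => rfl⟩
  have hmul : Realises (· * ·) (matMulOp 𝔽 n) := ⟨rfl, rfl, fun _ _ => rfl⟩
  refine ⟨isERamsey_of_inOmega (op := fun x _ => x) ?_ (Set.mem_singleton _) evaluates_fst he he0,
    isERamsey_of_inOmega (op := (· + ·)) ?_ (Or.inr rfl)
      (evaluates_of_realises (Or.inl rfl) hadd) he he0,
    isERamsey_of_inOmega (op := (· * ·)) ?_ (Or.inr rfl)
      (evaluates_of_realises (Or.inl rfl) hmul) he he0⟩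
  · exact fun g hg => Or.inl hg
  · rintro g (rfl | rfl)
    · exact Or.inr hadd
    · exact Or.inl rfl
  · rintro g (rfl | rfl)
    · exact Or.inr hmul
    · exact Or.inl rfl
end
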